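/- For real a > 0 and b ≥ 0, the integral over x from 0 to ∞ of sin(b·x·√(x²+1))/(x·√(x²+1)) · e^{-a x²} equals (π/2)·erf(√((√(a²+b²)−a)/2)), where erf(z) = (2/√π)·∫₀^z e^{-u²} du. -/

import Mathlib

open Real MeasureTheory

noncomputable def erf (z : ℝ) : ℝ := (2 / Real.sqrt π) * ∫ u in (0:ℝ)..z, Real.exp (-u^2)

open Filter Topology

theorem norm_sub_le_of_hasDerivAt_cexp_neg_sq {E : ℂ → ℂ}
    (hE : ∀ z, HasDerivAt E (Complex.exp (-z ^ 2)) z) (x y : ℝ) :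
    ‖E (x + y * Complex.I) - E x‖ ≤ Real.exp (y ^ 2 - x ^ 2) * |y| := by
  have hs : Convex ℝ (({x} : Set ℝ) ×ℂ Set.Icc (-|y|) |y|) :=
    ((convex_singleton x).linear_preimage Complex.reLm).inter
      ((convex_Icc (-|y|) |y|).linear_preimage Complex.imLm)
  have key := hs.norm_image_sub_le_of_norm_hasDerivWithin_le (𝕜 := ℂ) (f := E)
    (C := Real.exp (y ^ 2 - x ^ 2)) (x := (x : ℂ)) (y := x + y * Complex.I)
    (fun z _ => (hE z).hasDerivWithinAt) ?_ ?_ ?_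
  · simpa using key
  · rintro z ⟨hre, him⟩
    simp only [Set.mem_preimage, Set.mem_singleton_iff, Set.mem_Icc] at hre him
    rw [Complex.norm_exp, Real.exp_le_exp]
    have : z.im ^ 2 ≤ y ^ 2 := sq_le_sq.2 (abs_le.2 him)
    simp only [pow_two, Complex.neg_re, Complex.mul_re, hre] at this ⊢
    linarith
  · simp [Complex.mem_reProdIm]
  · simp [Complex.mem_reProdIm, neg_abs_le, le_abs_self]

theorem hasDerivAt_sqrt_sq_add_one (x : ℝ) :
    HasDerivAt (fun x : ℝ => √(x ^ 2 + 1)) (x / √(x ^ 2 + 1)) x := by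
  have h := (((hasDerivAt_id x).pow 2).add_const 1).sqrt (by simp; positivity)
  refine h.congr_deriv ?_
  simp
  field_simp

theorem tendsto_sqrt_sq_add_one_mul_exp {a : ℝ} (ha : 0 < a) (w : ℝ) :
    Tendsto (fun R : ℝ => Real.exp (w ^ 2 - a * R ^ 2) * (|w| * √(R ^ 2 + 1))) atTop (𝓝 0) := by
  have h (s : ℝ) : Tendsto (fun R : ℝ => R ^ s * Real.exp (-a * R ^ 2)) atTop (𝓝 0) :=
    (rpow_mul_exp_neg_mul_sq_isLittleO_exp_neg ha s).tendsto_zero_of_tendsto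
      (Real.tendsto_exp_atBot.comp <|
        tendsto_id.const_mul_atTop_of_neg (neg_lt_zero.mpr one_half_pos))
  have h2 := (((h 1).add (h 0)).const_mul (Real.exp (w ^ 2) * |w|))
  simp only [Real.rpow_one, Real.rpow_zero, add_zero, mul_zero] at h2
  refine squeeze_zero' (Eventually.of_forall fun R => by positivity) ?_ h2
  filter_upwards [eventually_ge_atTop 0] with R hR
  have hle : √(R ^ 2 + 1) ≤ R + 1 := Real.sqrt_le_iff.2 ⟨by linarith, by nlinarith⟩
  have : Real.exp (w ^ 2 - a * R ^ 2) = Real.exp (w ^ 2) * Real.exp (-a * R ^ 2) := by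
    rw [← Real.exp_add]; ring_nf
  rw [this]
  calc _ ≤ Real.exp (w ^ 2) * Real.exp (-a * R ^ 2) * (|w| * (R + 1)) := by gcongr
    _ = _ := by ring

/-- The integral of `exp (-γ ^ 2)` along the path `γ = α p - i w q` is the limit of the integrals
along its real part. -/
theorem tendsto_integral_cexp_neg_sq_path {a w α : ℝ} (ha : 0 < a) {p q p' q' : ℝ → ℝ} {l : ℂ}
    (hp : ∀ x, HasDerivAt p (p' x) x) (hq : ∀ x, HasDerivAt q (q' x) x)
    (hp' : Continuous p') (hq' : Continuous q')
    (hexp : ∀ x, w ^ 2 * q x ^ 2 - α ^ 2 * p x ^ 2 ≤ w ^ 2 - a * x ^ 2)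
    (hqle : ∀ x, |q x| ≤ √(x ^ 2 + 1))
    (hl : Tendsto (fun R : ℝ => ∫ x in (-R)..R,
      Complex.exp (-((α * p x : ℝ) : ℂ) ^ 2) * ((α * p' x : ℝ) : ℂ)) atTop (𝓝 l)) :
    Tendsto (fun R : ℝ => ∫ x in (-R)..R,
      Complex.exp (-((α * p x : ℝ) + (-w * q x : ℝ) * Complex.I) ^ 2) *
        ((α * p' x : ℝ) + (-w * q' x : ℝ) * Complex.I)) atTop (𝓝 l) := by
  obtain ⟨E, hE⟩ := (show Differentiable ℂ fun z : ℂ => Complex.exp (-z ^ 2) by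
    fun_prop).isExactOn_univ
  replace hE := fun z => hE z (Set.mem_univ z)
  have hpc : Continuous p := continuous_iff_continuousAt.2 fun x => (hp x).continuousAt
  have hqc : Continuous q := continuous_iff_continuousAt.2 fun x => (hq x).continuousAt
  have hpd (x : ℝ) : HasDerivAt (fun x => ((α * p x : ℝ) : ℂ)) ((α * p' x : ℝ) : ℂ) x :=
    ((hp x).const_mul α).ofReal_comp
  have hqd (x : ℝ) : HasDerivAt (fun x => ((-w * q x : ℝ) : ℂ)) ((-w * q' x : ℝ) : ℂ) x :=
    ((hq x).const_mul (-w)).ofReal_comp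
  have h1 (R : ℝ) : (∫ x in (-R)..R,
      Complex.exp (-((α * p x : ℝ) : ℂ) ^ 2) * ((α * p' x : ℝ) : ℂ)) =
      E (α * p R : ℝ) - E (α * p (-R) : ℝ) := by
    refine intervalIntegral.integral_eq_sub_of_hasDerivAt
      (f := fun x => E ((α * p x : ℝ) : ℂ)) (fun x _ => ?_) ?_
    · exact (hE _).comp x (hpd x)
    · exact Continuous.intervalIntegrable (by fun_prop) _ _
  have h2 (R : ℝ) : (∫ x in (-R)..R,
      Complex.exp (-((α * p x : ℝ) + (-w * q x : ℝ) * Complex.I) ^ 2) *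
        ((α * p' x : ℝ) + (-w * q' x : ℝ) * Complex.I)) =
      E ((α * p R : ℝ) + (-w * q R : ℝ) * Complex.I) -
        E ((α * p (-R) : ℝ) + (-w * q (-R) : ℝ) * Complex.I) := by
    refine intervalIntegral.integral_eq_sub_of_hasDerivAt
      (f := fun x : ℝ => E ((α * p x : ℝ) + (-w * q x : ℝ) * Complex.I)) (fun x _ => ?_) ?_
    · exact (hE _).comp x ((hpd x).add ((hqd x).mul_const _))
    · exact Continuous.intervalIntegrable (by fun_prop) _ _
  have hb (R : ℝ) : ‖E ((α * p R : ℝ) + (-w * q R : ℝ) * Complex.I) - E (α * p R : ℝ)‖ ≤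
      Real.exp (w ^ 2 - a * R ^ 2) * (|w| * √(R ^ 2 + 1)) := by
    refine (norm_sub_le_of_hasDerivAt_cexp_neg_sq hE _ _).trans ?_
    have e1 := hexp R
    rw [abs_mul, abs_neg]
    refine mul_le_mul (Real.exp_le_exp.2 ?_) ?_ (by positivity) (Real.exp_pos _).le
    · linarith [mul_pow (-w) (q R) 2, mul_pow α (p R) 2, neg_sq w]
    · exact mul_le_mul_of_nonneg_left (hqle R) (abs_nonneg w)
  simp_rw [h1] at hl
  simp_rw [h2]
  have hz := tendsto_sqrt_sq_add_one_mul_exp ha w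
  have hA := squeeze_zero_norm hb hz
  have hB := squeeze_zero_norm (fun R => hb (-R)) (by simpa using hz)
  have := (hl.add hA).sub hB
  simp only [add_zero, sub_zero] at this
  refine this.congr fun R => ?_
  ring

section
variable {a w α : ℝ}

theorem integrable_mul_exp_neg_mul_sq_of_abs_le_one (ha : 0 < a) {f : ℝ → ℝ} (hf : Continuous f)
    (h1 : ∀ x, |f x| ≤ 1) : Integrable fun x => f x * Real.exp (-a * x ^ 2) :=
  (integrable_exp_neg_mul_sq ha).bdd_mul (c := 1) hf.aestronglyMeasurable
    (Eventually.of_forall h1)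

theorem abs_div_sqrt_sq_add_one_le_one (x : ℝ) : |x / √(x ^ 2 + 1)| ≤ 1 := by
  rw [abs_div, abs_of_nonneg (Real.sqrt_nonneg _)]
  exact div_le_one_of_le₀ (Real.abs_le_sqrt (by linarith)) (Real.sqrt_nonneg _)

theorem continuous_div_sqrt_sq_add_one : Continuous fun x : ℝ => x / √(x ^ 2 + 1) :=
  continuous_id.div (by fun_prop) fun x => by positivity

theorem integrable_cos_mul_exp (ha : 0 < a) (b : ℝ) :
    Integrable fun x : ℝ => Real.cos (b * (x * √(x ^ 2 + 1))) * Real.exp (-a * x ^ 2) :=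
  integrable_mul_exp_neg_mul_sq_of_abs_le_one ha (by fun_prop) fun _ => Real.abs_cos_le_one _

theorem integrable_sin_mul_exp (ha : 0 < a) (b : ℝ) :
    Integrable fun x : ℝ => Real.sin (b * (x * √(x ^ 2 + 1))) * Real.exp (-a * x ^ 2) :=
  integrable_mul_exp_neg_mul_sq_of_abs_le_one ha (by fun_prop) fun _ => Real.abs_sin_le_one _

theorem integrable_cos_mul_div_mul_exp (ha : 0 < a) (b : ℝ) :
    Integrable fun x : ℝ => Real.cos (b * (x * √(x ^ 2 + 1))) * (x / √(x ^ 2 + 1)) *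
      Real.exp (-a * x ^ 2) :=
  integrable_mul_exp_neg_mul_sq_of_abs_le_one ha
    (Continuous.mul (by fun_prop) continuous_div_sqrt_sq_add_one) fun x => by
      rw [abs_mul]
      exact mul_le_one₀ (Real.abs_cos_le_one _) (abs_nonneg _) (abs_div_sqrt_sq_add_one_le_one x)

theorem integrable_sin_mul_div_mul_exp (ha : 0 < a) (b : ℝ) :
    Integrable fun x : ℝ => Real.sin (b * (x * √(x ^ 2 + 1))) * (x / √(x ^ 2 + 1)) *
      Real.exp (-a * x ^ 2) :=
  integrable_mul_exp_neg_mul_sq_of_abs_le_one ha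
    (Continuous.mul (by fun_prop) continuous_div_sqrt_sq_add_one) fun x => by
      rw [abs_mul]
      exact mul_le_one₀ (Real.abs_sin_le_one _) (abs_nonneg _) (abs_div_sqrt_sq_add_one_le_one x)

theorem cexp_eq_exp_mul_cos_add_sin {z : ℂ} {r s : ℝ} (hz : z = r + s * Complex.I) :
    Complex.exp z = (Real.exp r * Real.cos s : ℝ) + (Real.exp r * Real.sin s : ℝ) * Complex.I := by
  rw [hz, Complex.exp_add_mul_I]
  push_cast
  ring

theorem integral_eq_of_tendsto_integral {f : ℝ → ℂ} {g : ℝ → ℝ} {l : ℂ} (hfc : Continuous f)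
    (hl : Tendsto (fun R : ℝ => ∫ x in (-R)..R, f x) atTop (𝓝 l))
    (L : ℂ →L[ℝ] ℝ) (hg : Integrable g) (hfg : ∀ x, L (f x) = g x) : ∫ x, g x = L l := by
  refine tendsto_nhds_unique
    (intervalIntegral_tendsto_integral hg tendsto_neg_atTop_atBot tendsto_id) ?_
  refine ((L.continuous.tendsto l).comp hl).congr fun R => ?_
  simp_rw [Function.comp_apply, ← hfg]
  exact (L.intervalIntegral_comp_comm (hfc.intervalIntegrable _ _)).symm

theorem integral_cos_add_sin_eq (ha : 0 < a) (hα : 0 < α) (h : α ^ 2 = a + w ^ 2) :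
    α * (∫ x : ℝ, Real.cos (2 * w * α * (x * √(x ^ 2 + 1))) * Real.exp (-a * x ^ 2)) +
      w * (∫ x : ℝ, Real.sin (2 * w * α * (x * √(x ^ 2 + 1))) * (x / √(x ^ 2 + 1)) *
        Real.exp (-a * x ^ 2)) = √π * Real.exp (-w ^ 2) := by
  have hl : Tendsto (fun R : ℝ => ∫ x in (-R)..R,
      Complex.exp (-((α * x : ℝ) : ℂ) ^ 2) * ((α * 1 : ℝ) : ℂ)) atTop (𝓝 ((√π : ℝ) : ℂ)) := by
    have hi : Integrable fun x : ℝ => Real.exp (-α ^ 2 * x ^ 2) * α :=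
      (integrable_exp_neg_mul_sq (by positivity)).mul_const α
    have ht := intervalIntegral_tendsto_integral hi tendsto_neg_atTop_atBot tendsto_id
    have hv : ∫ x : ℝ, Real.exp (-α ^ 2 * x ^ 2) * α = √π := by
      rw [integral_mul_const, integral_gaussian, Real.sqrt_div Real.pi_pos.le,
        Real.sqrt_sq hα.le]
      field_simp
    rw [hv] at ht
    refine ((Complex.continuous_ofReal.tendsto _).comp ht).congr fun R => ?_
    simp only [Function.comp_apply, id]
    rw [← intervalIntegral.integral_ofReal]
    refine intervalIntegral.integral_congr fun x _ => ?_
    push_cast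
    ring_nf
  have ht := tendsto_integral_cexp_neg_sq_path (w := w) (α := α) ha (p := fun x => x)
    (fun x => hasDerivAt_id x) hasDerivAt_sqrt_sq_add_one continuous_const
    continuous_div_sqrt_sq_add_one
    (fun x => by
      rw [Real.sq_sqrt (by positivity), h]
      nlinarith) (fun x => (abs_of_nonneg (Real.sqrt_nonneg _)).le) hl
  have hexp (x : ℝ) : Complex.exp (-((α * x : ℝ) + (-w * √(x ^ 2 + 1) : ℝ) * Complex.I) ^ 2) =
      (Real.exp (w ^ 2 - a * x ^ 2) * Real.cos (2 * w * α * (x * √(x ^ 2 + 1))) : ℝ) +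
      (Real.exp (w ^ 2 - a * x ^ 2) * Real.sin (2 * w * α * (x * √(x ^ 2 + 1))) : ℝ) *
        Complex.I := by
    apply cexp_eq_exp_mul_cos_add_sin
    have hs : √(x ^ 2 + 1) ^ 2 = x ^ 2 + 1 := Real.sq_sqrt (by positivity)
    apply Complex.ext
    · simp [pow_two] at hs h ⊢
      linear_combination w ^ 2 * hs - x ^ 2 * h
    · simp [pow_two]
      ring
  have hint := (((integrable_cos_mul_exp ha (2 * w * α)).const_mul α).add
    ((integrable_sin_mul_div_mul_exp ha (2 * w * α)).const_mul w)).const_mul (Real.exp (w ^ 2))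
  have hfc : Continuous fun x : ℝ =>
      Complex.exp (-((α * x : ℝ) + (-w * √(x ^ 2 + 1) : ℝ) * Complex.I) ^ 2) *
        ((α * 1 : ℝ) + (-w * (x / √(x ^ 2 + 1)) : ℝ) * Complex.I) := by
    have := continuous_div_sqrt_sq_add_one
    fun_prop
  have := integral_eq_of_tendsto_integral hfc ht Complex.reCLM hint fun x => by
    rw [hexp, sub_eq_add_neg, Real.exp_add]
    simp only [Complex.reCLM_apply, Pi.add_apply, Complex.mul_re, Complex.mul_im, Complex.add_re,
      Complex.add_im, Complex.ofReal_re, Complex.ofReal_im, Complex.I_re, Complex.I_im]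
    ring_nf
  simp only [Pi.add_apply] at this
  rw [integral_const_mul, integral_add ((integrable_cos_mul_exp ha _).const_mul α)
    ((integrable_sin_mul_div_mul_exp ha _).const_mul w), integral_const_mul,
    integral_const_mul] at this
  rw [Real.exp_neg, ← div_eq_mul_inv, eq_div_iff (Real.exp_pos _).ne', mul_comm]
  simpa using this

theorem integral_sin_sub_cos_eq_zero (ha : 0 < a) (h : α ^ 2 = a + w ^ 2) :
    α * (∫ x : ℝ, Real.sin (2 * w * α * (x * √(x ^ 2 + 1))) * (x / √(x ^ 2 + 1)) *
        Real.exp (-a * x ^ 2)) -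
      w * (∫ x : ℝ, Real.cos (2 * w * α * (x * √(x ^ 2 + 1))) * Real.exp (-a * x ^ 2)) = 0 := by
  have hl : Tendsto (fun R : ℝ => ∫ x in (-R)..R,
      Complex.exp (-((α * √(x ^ 2 + 1) : ℝ) : ℂ) ^ 2) *
        ((α * (x / √(x ^ 2 + 1)) : ℝ) : ℂ)) atTop (𝓝 0) := by
    refine tendsto_const_nhds.congr fun R => ?_
    have := intervalIntegral.integral_comp_neg (a := -R) (b := R) fun x : ℝ =>
      Complex.exp (-((α * √(x ^ 2 + 1) : ℝ) : ℂ) ^ 2) * ((α * (x / √(x ^ 2 + 1)) : ℝ) : ℂ)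
    simp only [neg_sq, neg_div, mul_neg, Complex.ofReal_neg, neg_neg,
      intervalIntegral.integral_neg] at this
    exact (self_eq_neg.1 this.symm).symm
  have ht := tendsto_integral_cexp_neg_sq_path (w := w) (α := α) ha (q := fun x => x)
    hasDerivAt_sqrt_sq_add_one (fun x => hasDerivAt_id x)
    continuous_div_sqrt_sq_add_one continuous_const
    (fun x => by
      rw [Real.sq_sqrt (by positivity), h]
      nlinarith) (fun x => Real.abs_le_sqrt (by linarith)) hl
  have hexp (x : ℝ) : Complex.exp (-((α * √(x ^ 2 + 1) : ℝ) + (-w * x : ℝ) * Complex.I) ^ 2) =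
      (Real.exp (-α ^ 2 - a * x ^ 2) * Real.cos (2 * w * α * (x * √(x ^ 2 + 1))) : ℝ) +
      (Real.exp (-α ^ 2 - a * x ^ 2) * Real.sin (2 * w * α * (x * √(x ^ 2 + 1))) : ℝ) *
        Complex.I := by
    apply cexp_eq_exp_mul_cos_add_sin
    have hs : √(x ^ 2 + 1) ^ 2 = x ^ 2 + 1 := Real.sq_sqrt (by positivity)
    apply Complex.ext
    · simp [pow_two] at hs h ⊢
      linear_combination - α ^ 2 * hs - x ^ 2 * h
    · simp [pow_two]
      ring
  have hint := (((integrable_sin_mul_div_mul_exp ha (2 * w * α)).const_mul α).sub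
    ((integrable_cos_mul_exp ha (2 * w * α)).const_mul w)).const_mul (Real.exp (-α ^ 2))
  have hfc : Continuous fun x : ℝ =>
      Complex.exp (-((α * √(x ^ 2 + 1) : ℝ) + (-w * x : ℝ) * Complex.I) ^ 2) *
        ((α * (x / √(x ^ 2 + 1)) : ℝ) + (-w * 1 : ℝ) * Complex.I) := by
    have := continuous_div_sqrt_sq_add_one
    fun_prop
  have := integral_eq_of_tendsto_integral hfc ht Complex.imCLM hint fun x => by
    rw [hexp, sub_eq_add_neg, Real.exp_add]
    simp only [Complex.imCLM_apply, Pi.sub_apply, Complex.mul_re, Complex.mul_im, Complex.add_re,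
      Complex.add_im, Complex.ofReal_re, Complex.ofReal_im, Complex.I_re, Complex.I_im]
    ring_nf
  simp only [Pi.sub_apply] at this
  rw [integral_const_mul, integral_sub ((integrable_sin_mul_div_mul_exp ha _).const_mul α)
    ((integrable_cos_mul_exp ha _).const_mul w), integral_const_mul,
    integral_const_mul] at this
  simpa using this

theorem integral_Ioi_cos_mul_exp (ha : 0 < a) (hα : 0 < α) (h : α ^ 2 = a + w ^ 2) :
    ∫ x in Set.Ioi (0 : ℝ), Real.cos (2 * w * α * (x * √(x ^ 2 + 1))) * Real.exp (-a * x ^ 2) =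
      √π * Real.exp (-w ^ 2) * α / (2 * (α ^ 2 + w ^ 2)) := by
  have h1 := integral_cos_add_sin_eq ha hα h
  have h2 := integral_sin_sub_cos_eq_zero ha h
  have h3 := integral_comp_abs (f := fun x : ℝ =>
    Real.cos (2 * w * α * (x * √(x ^ 2 + 1))) * Real.exp (-a * x ^ 2))
  have h4 : (∫ x : ℝ, Real.cos (2 * w * α * (|x| * √(|x| ^ 2 + 1))) * Real.exp (-a * |x| ^ 2)) =
      ∫ x : ℝ, Real.cos (2 * w * α * (x * √(x ^ 2 + 1))) * Real.exp (-a * x ^ 2) := by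
    congr 1 with x
    rcases abs_choice x with hx | hx <;> simp [hx]
  rw [h4] at h3
  rw [h3] at h1 h2
  have : 0 < α ^ 2 + w ^ 2 := by positivity
  rw [eq_div_iff (by positivity)]
  linear_combination α * h1 - w * h2

end

/-- The substitution `b = 2 w √(a + w ^ 2)` turns the integral over `b` into a Gaussian one. -/
theorem integral_sin_div_mul_exp {a : ℝ} (ha : 0 < a) (W : ℝ) :
    ∫ x in Set.Ioi (0 : ℝ), Real.sin (2 * W * √(a + W ^ 2) * (x * √(x ^ 2 + 1))) /
      (x * √(x ^ 2 + 1)) * Real.exp (-a * x ^ 2) =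
      √π * ∫ w in (0 : ℝ)..W, Real.exp (-w ^ 2) := by
  have hpos (w : ℝ) : 0 < a + w ^ 2 := by positivity
  let B' : ℝ → ℝ := fun w => 2 * ((a + w ^ 2) + w ^ 2) / √(a + w ^ 2)
  have hB' : Continuous B' :=
    Continuous.div (by fun_prop) (by fun_prop) fun w => (Real.sqrt_pos.2 (hpos w)).ne'
  have hB (w : ℝ) : HasDerivAt (fun w : ℝ => 2 * w * √(a + w ^ 2)) (B' w) w := by
    have h1 := (((hasDerivAt_id w).pow 2).const_add a).sqrt (hpos w).ne'
    refine (((hasDerivAt_id w).const_mul 2).mul h1).congr_deriv ?_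
    have hs := Real.sq_sqrt (hpos w).le
    have hs0 := Real.sqrt_pos.2 (hpos w)
    simp only [B', id, Pi.pow_apply]
    field_simp
    rw [hs]
    simp
    ring
  have hinner (x : ℝ) (hx : x ∈ Set.Ioi (0 : ℝ)) :
      Real.sin (2 * W * √(a + W ^ 2) * (x * √(x ^ 2 + 1))) /
      (x * √(x ^ 2 + 1)) * Real.exp (-a * x ^ 2) = ∫ w in (0 : ℝ)..W,
        B' w * (Real.cos (2 * w * √(a + w ^ 2) * (x * √(x ^ 2 + 1))) * Real.exp (-a * x ^ 2)) := by
    have hx0 : x * √(x ^ 2 + 1) ≠ 0 := (mul_pos hx (by positivity)).ne'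
    have := intervalIntegral.integral_eq_sub_of_hasDerivAt (a := 0) (b := W)
      (f := fun w => Real.sin (2 * w * √(a + w ^ 2) * (x * √(x ^ 2 + 1))) /
        (x * √(x ^ 2 + 1)) * Real.exp (-a * x ^ 2))
      (f' := fun w => B' w * (Real.cos (2 * w * √(a + w ^ 2) * (x * √(x ^ 2 + 1))) *
        Real.exp (-a * x ^ 2)))
      (fun w _ => by
        refine (((((hB w).mul_const _).sin).div_const _).mul_const _).congr_deriv ?_
        rw [← mul_assoc (Real.cos _), mul_div_cancel_right₀ _ hx0]
        ring)
      (Continuous.intervalIntegrable (by fun_prop) _ _)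
    rw [this]
    simp
  rw [setIntegral_congr_fun measurableSet_Ioi hinner, ← intervalIntegral_integral_swap]
  · rw [← intervalIntegral.integral_const_mul]
    refine intervalIntegral.integral_congr fun w _ => ?_
    rw [integral_const_mul, integral_Ioi_cos_mul_exp ha (Real.sqrt_pos.2 (hpos w))
      (Real.sq_sqrt (hpos w).le), Real.sq_sqrt (hpos w).le]
    have hs0 := Real.sqrt_pos.2 (hpos w)
    have : 0 < a + w ^ 2 + w ^ 2 := by positivity
    simp only [B']
    field_simp
  · have hprod : Integrable (fun z : ℝ × ℝ => B' z.1 * Real.exp (-a * z.2 ^ 2))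
        ((volume.restrict (Set.uIoc 0 W)).prod (volume.restrict (Set.Ioi 0))) :=
      Integrable.mul_prod (hB'.integrableOn_uIoc)
        (integrable_exp_neg_mul_sq ha).integrableOn
    refine hprod.mono (Continuous.aestronglyMeasurable ?_) (Eventually.of_forall fun z => ?_)
    · simp only [Function.uncurry_def]
      fun_prop
    · simp only [Function.uncurry_def, norm_mul]
      gcongr
      exact mul_le_of_le_one_left (norm_nonneg _) (Real.abs_cos_le_one _)

theorem stmt8 (a b : ℝ) (ha : 0 < a) (hb : 0 ≤ b) :
    ∫ x in Set.Ioi (0:ℝ),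
        Real.sin (b * x * Real.sqrt (x^2 + 1)) / (x * Real.sqrt (x^2 + 1)) * Real.exp (-a * x^2)
      = π / 2 * erf (Real.sqrt ((Real.sqrt (a^2 + b^2) - a) / 2)) := by
  have hr : √(a ^ 2 + b ^ 2) ^ 2 = a ^ 2 + b ^ 2 := Real.sq_sqrt (by positivity)
  have har : a ≤ √(a ^ 2 + b ^ 2) := Real.le_sqrt_of_sq_le (by nlinarith)
  set r := √(a ^ 2 + b ^ 2)
  have hW : √((r - a) / 2) ^ 2 = (r - a) / 2 := Real.sq_sqrt (by linarith)
  have hbW : 2 * √((r - a) / 2) * √(a + √((r - a) / 2) ^ 2) = b := by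
    rw [hW, mul_assoc, ← Real.sqrt_mul (by linarith),
      show (r - a) / 2 * (a + (r - a) / 2) = (b / 2) ^ 2 by linear_combination hr / 4,
      Real.sqrt_sq (by positivity)]
    ring
  have key := integral_sin_div_mul_exp ha √((r - a) / 2)
  rw [hbW] at key
  simp_rw [mul_assoc b]
  rw [key, erf, ← mul_assoc]
  congr 1
  have := Real.sq_sqrt Real.pi_pos.le
  field_simp
  exact this
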